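/- arXiv:1602.05173 — 2 statements merged into one kernel-verified Lean document; each statement's English description precedes it below -/
import Mathlib

section
/- Let L be a first-order language, κ > |L| an uncountable cardinal, and M a κ-saturated L-structure. Then the following are equivalent: (1) (functional unimodularity for types) for every A ⊆ M with |A| < κ, all nonempty sets X, Y type-definable over A, and all functions f, g : X → Y that are relatively definable over A and such that every fibre f⁻¹(y) has exactly k elements and every fibre g⁻¹(y) has exactly ℓ elements (for all y ∈ Y), one has k = ℓ; (2) (correspondence unimodularity for types) for every A ⊆ M with |A| < κ and all sets X, Y type-definable over A, any two uniform correspondences C₁, C₂ over A between X and Y satisfy m_{C₁} = m_{C₂}. -/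
open FirstOrder Set

namespace Unimod

universe u v w

variable (L : FirstOrder.Language.{u, v}) {M : Type w} [L.Structure M]

/-- Two tuples (indexed by `α`) satisfy the same `L`-formulas with parameters from `A`,
i.e. they have the same complete type over `A`. -/
def SameType (A : Set M) {α : Type*} (a b : α → M) : Prop :=
  ∀ φ : L.Formula (↥A ⊕ α),
    φ.Realize (Sum.elim (fun x => (x : M)) a) ↔ φ.Realize (Sum.elim (fun x => (x : M)) b)

/-- The set of realizations of the complete type of the tuple `a` over `A`. -/
def typeSet (A : Set M) {α : Type*} (a : α → M) : Set (α → M) :=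
  {b | SameType L A a b}

/-- A set is type-definable over `A` if it is an intersection of a family of `A`-definable
sets. -/
def TypeDefinable (A : Set M) {α : Type*} (s : Set (α → M)) : Prop :=
  ∃ S : Set (Set (α → M)), (∀ t ∈ S, A.Definable L t) ∧ s = ⋂₀ S

/-- View a set of pairs of tuples as a set of `Fin n ⊕ Fin m`-indexed tuples. -/
def pairSet {M : Type w} {n m : ℕ} (C : Set ((Fin n → M) × (Fin m → M))) :
    Set ((Fin n ⊕ Fin m) → M) :=
  {v | (v ∘ Sum.inl, v ∘ Sum.inr) ∈ C}

/-- A correspondence over `A` between `X ⊆ M^n` and `Y ⊆ M^m`: a nonempty subset of `X × Y`,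
type-definable over `A`, all of whose fibres and cofibres are finite. -/
structure IsCorrespondence (A : Set M) {n m : ℕ} (X : Set (Fin n → M)) (Y : Set (Fin m → M))
    (C : Set ((Fin n → M) × (Fin m → M))) : Prop where
  nonempty : C.Nonempty
  subset : C ⊆ X ×ˢ Y
  typeDefinable : TypeDefinable L A (pairSet C)
  finite_fibers : ∀ x ∈ X, {y | (x, y) ∈ C}.Finite
  finite_cofibers : ∀ y ∈ Y, {x | (x, y) ∈ C}.Finite

/-- A uniform correspondence over `A` with constant fibre size `k` and cofibre size `ℓ`. -/
structure IsUniformCorrespondence (A : Set M) {n m : ℕ} (X : Set (Fin n → M))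
    (Y : Set (Fin m → M)) (C : Set ((Fin n → M) × (Fin m → M))) (k ℓ : ℕ)
    extends IsCorrespondence L A X Y C : Prop where
  k_pos : 0 < k
  l_pos : 0 < ℓ
  fiber_card : ∀ x ∈ X, {y | (x, y) ∈ C}.ncard = k
  cofiber_card : ∀ y ∈ Y, {x | (x, y) ∈ C}.ncard = ℓ

/-- A type-definable set `X` is measurable over `A` if every uniform correspondence over `A`
between `X` and itself is balanced. -/
def MeasurableOver (A : Set M) {n : ℕ} (X : Set (Fin n → M)) : Prop :=
  ∀ (C : Set ((Fin n → M) × (Fin n → M))) (k ℓ : ℕ),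
    IsUniformCorrespondence L A X X C k ℓ → k = ℓ

/-- `X` and `Y` are commensurable over `A`, with common ratio `r`. -/
def CommensurableOverWithRatio (A : Set M) {n m : ℕ} (X : Set (Fin n → M))
    (Y : Set (Fin m → M)) (r : ℚ) : Prop :=
  (∃ C k ℓ, IsUniformCorrespondence L A X Y C k ℓ) ∧
    ∀ C k ℓ, IsUniformCorrespondence L A X Y C k ℓ → (k : ℚ) / (ℓ : ℚ) = r

/-- `X` and `Y` are commensurable over `A`: there is a uniform correspondence over `A` between
them, and all such have the same ratio. -/
def CommensurableOver (A : Set M) {n m : ℕ} (X : Set (Fin n → M)) (Y : Set (Fin m → M)) : Prop :=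
  ∃ r : ℚ, CommensurableOverWithRatio L A X Y r

/-- `M` is strongly homogeneous over `A`: any two tuples with the same type over `A` are
conjugate by an automorphism of `M` fixing `A` pointwise. -/
def StronglyHomogeneousOver (A : Set M) : Prop :=
  ∀ (n : ℕ) (a b : Fin n → M), SameType L A a b →
    ∃ σ : M ≃[L] M, (∀ x ∈ A, σ x = x) ∧ ∀ i, σ (a i) = b i

/-- `M` is unimodular (with respect to the cardinal bound `κ` on parameter sets):
whenever `a ≡_A b` are interalgebraic over `A`, then `m(a/A ∪ b) = m(b/A ∪ a)`. -/
def Unimodular (κ : Cardinal.{w}) : Prop :=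
  ∀ A : Set M, Cardinal.mk A < κ → ∀ (n : ℕ) (a b : Fin n → M),
    SameType L A a b →
    (typeSet L (A ∪ Set.range b) a).Finite →
    (typeSet L (A ∪ Set.range a) b).Finite →
    (typeSet L (A ∪ Set.range b) a).ncard = (typeSet L (A ∪ Set.range a) b).ncard

/-- `M` is `κ`-saturated: every finitely satisfiable set of formulas in finitely many free
variables with parameters from a set of size `< κ` is realized in `M`. -/
def Saturated (κ : Cardinal.{w}) : Prop :=
  ∀ A : Set M, Cardinal.mk A < κ →
    ∀ (n : ℕ) (T : Set (L.Formula (↥A ⊕ Fin n))),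
      (∀ T₀ : Finset (L.Formula (↥A ⊕ Fin n)), ↑T₀ ⊆ T →
        ∃ v : Fin n → M, ∀ φ ∈ T₀, φ.Realize (Sum.elim (fun x => (x : M)) v)) →
      ∃ v : Fin n → M, ∀ φ ∈ T, φ.Realize (Sum.elim (fun x => (x : M)) v)

/-- A function `f : X → Y` is relatively definable over `A` if its graph is the intersection
of an `A`-definable set with `X × Y`. -/
def RelativelyDefinableFn (A : Set M) {n m : ℕ} (X : Set (Fin n → M)) (Y : Set (Fin m → M))
    (f : (Fin n → M) → (Fin m → M)) : Prop :=
  ∃ D : Set ((Fin n ⊕ Fin m) → M), A.Definable L D ∧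
    ∀ x ∈ X, ∀ y ∈ Y, (Sum.elim x y ∈ D ↔ f x = y)

/-- The `≡_A`-class of the pair `c`. -/
def pairClass (A : Set M) {n m : ℕ} (c : (Fin n → M) × (Fin m → M)) :
    Set ((Fin n → M) × (Fin m → M)) :=
  {p | SameType L A (Sum.elim c.1 c.2) (Sum.elim p.1 p.2)}

/-- A complete correspondence over `A`: a correspondence which is a single `≡_A`-class. -/
def IsCompleteCorrespondence (A : Set M) {n m : ℕ} (X : Set (Fin n → M)) (Y : Set (Fin m → M))
    (C : Set ((Fin n → M) × (Fin m → M))) : Prop :=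
  IsCorrespondence L A X Y C ∧ ∃ c ∈ C, C = pairClass L A c


namespace TypeDefinable

variable {L} {A : Set M} {α β : Type*}

theorem inter {s t : Set (α → M)} (hs : TypeDefinable L A s) (ht : TypeDefinable L A t) :
    TypeDefinable L A (s ∩ t) := by
  obtain ⟨S, hS, rfl⟩ := hs
  obtain ⟨T, hT, rfl⟩ := ht
  exact ⟨S ∪ T, fun u hu => hu.elim (hS u) (hT u), (sInter_union S T).symm⟩

theorem preimage_comp {s : Set (α → M)} (hs : TypeDefinable L A s) (e : α → β) :
    TypeDefinable L A ((fun v : β → M => v ∘ e) ⁻¹' s) := by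
  obtain ⟨S, hS, rfl⟩ := hs
  refine ⟨(fun t => (fun v : β → M => v ∘ e) ⁻¹' t) '' S, ?_, ?_⟩
  · rintro _ ⟨t, ht, rfl⟩
    exact (hS t ht).preimage_comp e
  · rw [sInter_image, preimage_sInter]

theorem of_definable {s : Set (α → M)} (hs : A.Definable L s) : TypeDefinable L A s :=
  ⟨{s}, by simpa using hs, (sInter_singleton s).symm⟩

end TypeDefinable

theorem definable_setOf_coord_eq (A : Set M) {α : Type*} (i j : α) :
    A.Definable L {v : α → M | v i = v j} :=
  ⟨(Language.Term.var i).equal (Language.Term.var j), by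
    ext v
    simp [Language.Formula.realize_equal]⟩

theorem relativelyDefinableFn_comp (A : Set M) {n m : ℕ} (X : Set (Fin n → M))
    (Y : Set (Fin m → M)) (i : Fin m → Fin n) :
    RelativelyDefinableFn L A X Y (fun x => x ∘ i) := by
  refine ⟨⋂ a ∈ (Finset.univ : Finset (Fin m)),
      {v : Fin n ⊕ Fin m → M | v (Sum.inl (i a)) = v (Sum.inr a)},
    definable_biInter_finset (fun a => definable_setOf_coord_eq L A _ _) _, fun x _ y _ => ?_⟩
  simp [funext_iff]

theorem finite_and_ncard_dependent_prod {β γ : Type*} {S : Set β} {T : β → Set γ} {l : ℕ}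
    (hS : S.Finite) (hT : ∀ b ∈ S, (T b).Finite) (hl : ∀ b ∈ S, (T b).ncard = l) :
    {p : β × γ | p.1 ∈ S ∧ p.2 ∈ T p.1}.Finite ∧
      {p : β × γ | p.1 ∈ S ∧ p.2 ∈ T p.1}.ncard = S.ncard * l := by
  have := hS.to_subtype
  have (b : S) : Finite (T b) := (hT b b.2).to_subtype
  let e : {p : β × γ | p.1 ∈ S ∧ p.2 ∈ T p.1} ≃ Σ b : S, T b :=
    { toFun := fun p => ⟨⟨p.1.1, p.2.1⟩, ⟨p.1.2, p.2.2⟩⟩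
      invFun := fun q => ⟨(q.1.1, q.2.1), q.1.2, q.2.2⟩
      left_inv := fun _ => rfl
      right_inv := fun _ => rfl }
  refine ⟨Set.finite_coe_iff.mp (Finite.of_equiv _ e.symm), ?_⟩
  have := Fintype.ofFinite S
  rw [← Nat.card_coe_set_eq, Nat.card_congr e, Nat.card_sigma,
    Finset.sum_congr rfl fun (b : S) _ => (Nat.card_coe_set_eq (T b)).trans (hl b b.2),
    Finset.sum_const, smul_eq_mul, Finset.card_univ, ← Nat.card_eq_fintype_card,
    Nat.card_coe_set_eq]

section

variable {L}

/-- The graph of a relatively definable function all of whose fibres have `k` elements is a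
uniform correspondence. -/
theorem RelativelyDefinableFn.isUniformCorrespondence {A : Set M} {n m : ℕ}
    {X : Set (Fin n → M)} {Y : Set (Fin m → M)} {f : (Fin n → M) → (Fin m → M)} {k : ℕ}
    (hf : RelativelyDefinableFn L A X Y f) (hX : TypeDefinable L A X) (hY : TypeDefinable L A Y)
    (hne : X.Nonempty) (hmaps : MapsTo f X Y)
    (hk : ∀ y ∈ Y, {x ∈ X | f x = y}.Finite ∧ {x ∈ X | f x = y}.ncard = k) :
    IsUniformCorrespondence L A X Y {p | p.1 ∈ X ∧ f p.1 = p.2} 1 k := by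
  obtain ⟨x₀, hx₀⟩ := hne
  have hfib : ∀ x ∈ X, {y | (x, y) ∈ {p : (Fin n → M) × (Fin m → M) | p.1 ∈ X ∧ f p.1 = p.2}}
      = {f x} := fun x hx => by
    ext y
    simp [hx, eq_comm]
  refine ⟨⟨⟨(x₀, f x₀), hx₀, rfl⟩, ?_, ?_, fun x hx => ?_, fun y hy => (hk y hy).1⟩,
    one_pos, ?_, fun x hx => ?_, fun y hy => (hk y hy).2⟩
  · rintro ⟨x, y⟩ ⟨hx, hxy⟩
    exact ⟨hx, hxy.subst (motive := (· ∈ Y)) (hmaps hx)⟩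
  · obtain ⟨D, hD, hDf⟩ := hf
    convert ((hX.preimage_comp Sum.inl).inter (hY.preimage_comp Sum.inr)).inter
      (TypeDefinable.of_definable hD) using 1
    ext v
    constructor
    · rintro ⟨hx, hxy⟩
      have hy : v ∘ Sum.inr ∈ Y := hxy.subst (motive := (· ∈ Y)) (hmaps hx)
      exact ⟨⟨hx, hy⟩, by simpa using (hDf _ hx _ hy).2 hxy⟩
    · rintro ⟨⟨hx, hy⟩, hv⟩
      exact ⟨hx, (hDf _ hx _ hy).1 (by simpa using hv)⟩
  · rw [hfib x hx]
    exact finite_singleton _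
  · rw [← (hk _ (hmaps hx₀)).2, ncard_pos (hk _ (hmaps hx₀)).1]
    exact ⟨x₀, hx₀, rfl⟩
  · rw [hfib x hx, ncard_singleton]

/-- The triples `(x, y, x')`, coded as a single tuple, with `(x, y) ∈ C` and `(x', y) ∈ D`. -/
def fiberProduct {n m : ℕ} (C D : Set ((Fin n → M) × (Fin m → M))) :
    Set (Fin ((n + m) + n) → M) :=
  {z | (z ∘ Fin.castAdd n ∘ Fin.castAdd m, z ∘ Fin.castAdd n ∘ Fin.natAdd n) ∈ C ∧
    (z ∘ Fin.natAdd (n + m), z ∘ Fin.castAdd n ∘ Fin.natAdd n) ∈ D}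

theorem typeDefinable_fiberProduct {A : Set M} {n m : ℕ}
    {C D : Set ((Fin n → M) × (Fin m → M))} (hC : TypeDefinable L A (pairSet C))
    (hD : TypeDefinable L A (pairSet D)) : TypeDefinable L A (fiberProduct C D) :=
  (hC.preimage_comp (Sum.elim (Fin.castAdd n ∘ Fin.castAdd m) (Fin.castAdd n ∘ Fin.natAdd n))).inter
    (hD.preimage_comp (Sum.elim (Fin.natAdd (n + m)) (Fin.castAdd n ∘ Fin.natAdd n)))

variable {A : Set M} {n m : ℕ} {X : Set (Fin n → M)} {Y : Set (Fin m → M)}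
  {C D : Set ((Fin n → M) × (Fin m → M))} {k₁ ℓ₁ k₂ ℓ₂ : ℕ}

theorem fiberProduct_fst_fiber (hC : IsUniformCorrespondence L A X Y C k₁ ℓ₁)
    (hD : IsUniformCorrespondence L A X Y D k₂ ℓ₂) {x : Fin n → M} (hx : x ∈ X) :
    {z ∈ fiberProduct C D | z ∘ (Fin.castAdd n ∘ Fin.castAdd m) = x}.Finite ∧
      {z ∈ fiberProduct C D | z ∘ (Fin.castAdd n ∘ Fin.castAdd m) = x}.ncard = k₁ * ℓ₂ := by
  obtain ⟨hfin, hcard⟩ := finite_and_ncard_dependent_prod (hC.finite_fibers x hx)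
    (T := fun y => {x' | (x', y) ∈ D})
    (fun y hy => hD.finite_cofibers y (hC.subset hy).2)
    (fun y hy => hD.cofiber_card y (hC.subset hy).2)
  have himage : {z ∈ fiberProduct C D | z ∘ (Fin.castAdd n ∘ Fin.castAdd m) = x} =
      (fun p : (Fin m → M) × (Fin n → M) => Fin.append (Fin.append x p.1) p.2) ''
        {p | p.1 ∈ {y | (x, y) ∈ C} ∧ p.2 ∈ {x' | (x', p.1) ∈ D}} := by
    ext z
    constructor
    · rintro ⟨⟨h₁, h₂⟩, rfl⟩
      refine ⟨(z ∘ Fin.castAdd n ∘ Fin.natAdd n, z ∘ Fin.natAdd (n + m)), ⟨h₁, h₂⟩, ?_⟩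
      ext a
      refine Fin.addCases (fun a => ?_) (fun a => ?_) a
      · refine Fin.addCases (fun a => ?_) (fun a => ?_) a <;> simp
      · simp
    · rintro ⟨⟨y, x'⟩, ⟨h₁, h₂⟩, rfl⟩
      simp_all [fiberProduct, Function.comp_def]
  have hinj : Function.Injective
      (fun p : (Fin m → M) × (Fin n → M) => Fin.append (Fin.append x p.1) p.2) := by
    rintro ⟨y, x'⟩ ⟨y', x''⟩ h
    have h₁ := congrArg (fun z => z ∘ Fin.castAdd n ∘ Fin.natAdd n) h
    have h₂ := congrArg (fun z => z ∘ Fin.natAdd (n + m)) h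
    exact Prod.ext (by simpa [Function.comp_def] using h₁) (by simpa [Function.comp_def] using h₂)
  rw [himage, ncard_image_of_injective _ hinj, hcard, hC.fiber_card x hx]
  exact ⟨hfin.image _, rfl⟩

theorem fiberProduct_snd_fiber (hC : IsUniformCorrespondence L A X Y C k₁ ℓ₁)
    (hD : IsUniformCorrespondence L A X Y D k₂ ℓ₂) {x : Fin n → M} (hx : x ∈ X) :
    {z ∈ fiberProduct C D | z ∘ Fin.natAdd (n + m) = x}.Finite ∧
      {z ∈ fiberProduct C D | z ∘ Fin.natAdd (n + m) = x}.ncard = k₂ * ℓ₁ := by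
  obtain ⟨hfin, hcard⟩ := finite_and_ncard_dependent_prod (hD.finite_fibers x hx)
    (T := fun y => {x' | (x', y) ∈ C})
    (fun y hy => hC.finite_cofibers y (hD.subset hy).2)
    (fun y hy => hC.cofiber_card y (hD.subset hy).2)
  have himage : {z ∈ fiberProduct C D | z ∘ Fin.natAdd (n + m) = x} =
      (fun p : (Fin m → M) × (Fin n → M) => Fin.append (Fin.append p.2 p.1) x) ''
        {p | p.1 ∈ {y | (x, y) ∈ D} ∧ p.2 ∈ {x' | (x', p.1) ∈ C}} := by
    ext z
    constructor
    · rintro ⟨⟨h₁, h₂⟩, rfl⟩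
      refine ⟨(z ∘ Fin.castAdd n ∘ Fin.natAdd n, z ∘ Fin.castAdd n ∘ Fin.castAdd m),
        ⟨h₂, h₁⟩, ?_⟩
      ext a
      refine Fin.addCases (fun a => ?_) (fun a => ?_) a
      · refine Fin.addCases (fun a => ?_) (fun a => ?_) a <;> simp
      · simp
    · rintro ⟨⟨y, x'⟩, ⟨h₁, h₂⟩, rfl⟩
      simp_all [fiberProduct, Function.comp_def]
  have hinj : Function.Injective
      (fun p : (Fin m → M) × (Fin n → M) => Fin.append (Fin.append p.2 p.1) x) := by
    rintro ⟨y, x'⟩ ⟨y', x''⟩ h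
    have h₁ := congrArg (fun z => z ∘ Fin.castAdd n ∘ Fin.natAdd n) h
    have h₂ := congrArg (fun z => z ∘ Fin.castAdd n ∘ Fin.castAdd m) h
    exact Prod.ext (by simpa [Function.comp_def] using h₁) (by simpa [Function.comp_def] using h₂)
  rw [himage, ncard_image_of_injective _ hinj, hcard, hD.fiber_card x hx]
  exact ⟨hfin.image _, rfl⟩

end

/-- For a `κ`-saturated structure (`κ > |L|` uncountable), functional
unimodularity for types is equivalent to correspondence unimodularity for types. -/
theorem statement2 (L : FirstOrder.Language.{u, u}) (M : Type u) [L.Structure M]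
    (κ : Cardinal.{u}) (hκ : Cardinal.aleph0 < κ) (hLκ : L.card < κ)
    (hsat : Saturated L (M := M) κ) :
    -- functional unimodularity for types
    (∀ A : Set M, Cardinal.mk A < κ → ∀ (n m : ℕ)
      (X : Set (Fin n → M)) (Y : Set (Fin m → M)),
      TypeDefinable L A X → TypeDefinable L A Y → X.Nonempty → Y.Nonempty →
      ∀ (f g : (Fin n → M) → (Fin m → M)) (k ℓ : ℕ),
        Set.MapsTo f X Y → Set.MapsTo g X Y →
        RelativelyDefinableFn L A X Y f → RelativelyDefinableFn L A X Y g →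
        (∀ y ∈ Y, ({x ∈ X | f x = y}).Finite ∧ ({x ∈ X | f x = y}).ncard = k) →
        (∀ y ∈ Y, ({x ∈ X | g x = y}).Finite ∧ ({x ∈ X | g x = y}).ncard = ℓ) →
        k = ℓ) ↔
    -- correspondence unimodularity for types
    (∀ A : Set M, Cardinal.mk A < κ → ∀ (n m : ℕ)
      (X : Set (Fin n → M)) (Y : Set (Fin m → M)),
      TypeDefinable L A X → TypeDefinable L A Y →
      ∀ (C₁ C₂ : Set ((Fin n → M) × (Fin m → M))) (k₁ ℓ₁ k₂ ℓ₂ : ℕ),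
        IsUniformCorrespondence L A X Y C₁ k₁ ℓ₁ →
        IsUniformCorrespondence L A X Y C₂ k₂ ℓ₂ →
        (k₁ : ℚ) / (ℓ₁ : ℚ) = (k₂ : ℚ) / (ℓ₂ : ℚ)) := by
  constructor
  · intro h A hA n m X Y hX _ C₁ C₂ k₁ ℓ₁ k₂ ℓ₂ h₁ h₂
    obtain ⟨p, hp⟩ := h₁.nonempty
    have hpX : p.1 ∈ X := (h₁.subset hp).1
    have hZne : (fiberProduct C₁ C₂).Nonempty := by
      have hfib := fiberProduct_fst_fiber h₁ h₂ hpX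
      have hpos := Nat.mul_pos h₁.k_pos h₂.l_pos
      rw [← hfib.2, ncard_pos hfib.1] at hpos
      exact hpos.mono fun z hz => hz.1
    have key : k₁ * ℓ₂ = k₂ * ℓ₁ :=
      h A hA _ _ _ X (typeDefinable_fiberProduct h₁.typeDefinable h₂.typeDefinable) hX hZne
        ⟨p.1, hpX⟩ _ _ _ _ (fun z hz => (h₁.subset hz.1).1) (fun z hz => (h₂.subset hz.2).1)
        (relativelyDefinableFn_comp L A _ X _) (relativelyDefinableFn_comp L A _ X _)
        (fun x hx => fiberProduct_fst_fiber h₁ h₂ hx)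
        (fun x hx => fiberProduct_snd_fiber h₁ h₂ hx)
    rw [div_eq_div_iff (by exact_mod_cast h₁.l_pos.ne') (by exact_mod_cast h₂.l_pos.ne')]
    exact_mod_cast key
  · intro h A hA n m X Y hX hY hXne _ f g k ℓ hfm hgm hf hg hfk hgl
    have := h A hA n m X Y hX hY _ _ _ _ _ _
      (hf.isUniformCorrespondence hX hY hXne hfm hfk)
      (hg.isUniformCorrespondence hX hY hXne hgm hgl)
    simpa using this


end Unimod
end

section
/- Let M be an L-structure, A ⊆ M, and suppose M is strongly homogeneous over A. Let p be a complete type over A, π a set type-definable over A, and C a correspondence over A between p(M) and π, and let k = |C_x| (which is independent of x ∈ p(M)). Then C can be written as a disjoint union C = C₀ ∪ … ∪ C_n with n + 1 ≤ k, where each C_i is of the form {(x,y) : (x,y) ≡_A (a_i,b_i)} for some (a_i,b_i) ∈ C, and each C_i is itself a correspondence over A between p(M) and π. -/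
open FirstOrder Set

namespace Unimod

universe u v w

variable (L : FirstOrder.Language.{u, v}) {M : Type w} [L.Structure M]

section

theorem SameType.refl (A : Set M) {α : Type*} (a : α → M) : SameType L A a a :=
  fun _ => Iff.rfl

variable {L}

theorem SameType.symm {A : Set M} {α : Type*} {a b : α → M} (h : SameType L A a b) :
    SameType L A b a :=
  fun φ => (h φ).symm

theorem SameType.trans {A : Set M} {α : Type*} {a b c : α → M} (h : SameType L A a b)
    (h' : SameType L A b c) : SameType L A a c :=
  fun φ => (h φ).trans (h' φ)

/-- An automorphism fixing `A` pointwise preserves types over `A`. -/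
theorem sameType_comp_equiv {A : Set M} {α : Type*} (σ : M ≃[L] M) (hσ : ∀ x ∈ A, σ x = x)
    (a : α → M) : SameType L A a (σ ∘ a) := by
  intro φ
  have h : Sum.elim (fun x : A => (x : M)) (σ ∘ a) = σ ∘ Sum.elim (fun x : A => (x : M)) a := by
    funext i
    rcases i with i | i
    · exact (hσ i i.2).symm
    · rfl
  rw [h, FirstOrder.Language.StrongHomClass.realize_formula]

/-- A set is definable over `A` iff it is cut out by an `L`-formula whose parameters from `A`
are plugged in as variables. -/
theorem definable_iff_exists_formula {A : Set M} {α : Type*} {t : Set (α → M)} :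
    A.Definable L t ↔ ∃ φ : L.Formula (A ⊕ α),
      t = {v | φ.Realize (Sum.elim (fun x => (x : M)) v)} := by
  have key (φ : (L.withConstants A).Formula α) (v : α → M) :
      FirstOrder.Language.Formula.Realize
        (FirstOrder.Language.BoundedFormula.constantsVarsEquiv φ)
        (Sum.elim (fun x : A => (x : M)) v) ↔ φ.Realize v :=
    FirstOrder.Language.BoundedFormula.realize_constantsVarsEquiv
  constructor
  · rintro ⟨φ, rfl⟩
    refine ⟨FirstOrder.Language.BoundedFormula.constantsVarsEquiv φ, ?_⟩
    ext v
    exact (key φ v).symm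
  · rintro ⟨φ, rfl⟩
    refine ⟨FirstOrder.Language.BoundedFormula.constantsVarsEquiv.symm φ, ?_⟩
    ext v
    have h := key (FirstOrder.Language.BoundedFormula.constantsVarsEquiv.symm φ) v
    rwa [Equiv.apply_symm_apply] at h

/-- Type-definable sets over `A` are closed under having the same type over `A`. -/
theorem TypeDefinable.mem_of_sameType {A : Set M} {α : Type*} {s : Set (α → M)}
    (hs : TypeDefinable L A s) {a b : α → M} (h : SameType L A a b) (ha : a ∈ s) : b ∈ s := by
  obtain ⟨S, hS, rfl⟩ := hs
  intro t ht
  have hat := ha t ht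
  obtain ⟨φ, rfl⟩ := definable_iff_exists_formula.1 (hS t ht)
  exact (h φ).1 hat

theorem typeDefinable_typeSet (A : Set M) {α : Type*} (a : α → M) :
    TypeDefinable L A (typeSet L A a) := by
  refine ⟨{t | A.Definable L t ∧ a ∈ t}, fun t ht => ht.1, ?_⟩
  ext b
  constructor
  · rintro h t ⟨ht, hat⟩
    obtain ⟨φ, rfl⟩ := definable_iff_exists_formula.1 ht
    exact (h φ).1 hat
  · intro h φ
    have hdef : A.Definable L {v : α → M | φ.Realize (Sum.elim (fun x => (x : M)) v)} :=
      definable_iff_exists_formula.2 ⟨φ, rfl⟩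
    refine ⟨fun ha => h _ ⟨hdef, ha⟩, fun hb => ?_⟩
    by_contra ha
    exact h _ ⟨hdef.compl, ha⟩ hb

theorem pairSet_pairClass (A : Set M) {n m : ℕ} (c : (Fin n → M) × (Fin m → M)) :
    pairSet (pairClass L A c) = typeSet L A (Sum.elim c.1 c.2) := by
  ext v
  simp only [pairSet, pairClass, typeSet, mem_ofPred_eq, Sum.elim_comp_inl_inr]

theorem pairClass_subset {A : Set M} {n m : ℕ} {C : Set ((Fin n → M) × (Fin m → M))}
    (hC : TypeDefinable L A (pairSet C)) {c : (Fin n → M) × (Fin m → M)} (hc : c ∈ C) :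
    pairClass L A c ⊆ C :=
  fun _ hp => hC.mem_of_sameType (a := Sum.elim c.1 c.2) hp hc

theorem IsCorrespondence.pairClass {A : Set M} {n m : ℕ} {X : Set (Fin n → M)}
    {Y : Set (Fin m → M)} {C : Set ((Fin n → M) × (Fin m → M))} (hC : IsCorrespondence L A X Y C)
    {c : (Fin n → M) × (Fin m → M)} (hc : c ∈ C) :
    IsCorrespondence L A X Y (pairClass L A c) where
  nonempty := ⟨c, SameType.refl L A _⟩
  subset := (pairClass_subset hC.typeDefinable hc).trans hC.subset
  typeDefinable := pairSet_pairClass (L := L) A c ▸ typeDefinable_typeSet A _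
  finite_fibers x hx :=
    (hC.finite_fibers x hx).subset fun _ hy => pairClass_subset hC.typeDefinable hc hy
  finite_cofibers y hy :=
    (hC.finite_cofibers y hy).subset fun _ hx => pairClass_subset hC.typeDefinable hc hx

/-- By strong homogeneity, the class over `A` of a pair meets the fibre over every realization of
the type of its first coordinate. -/
theorem StronglyHomogeneousOver.exists_mem_pairClass {A : Set M}
    (hhom : StronglyHomogeneousOver L A) {n m : ℕ} {x a : Fin n → M} (h : SameType L A x a)
    (y : Fin m → M) : ∃ z, (a, z) ∈ pairClass L A (x, y) := by
  obtain ⟨σ, hσ, hσx⟩ := hhom n x a h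
  refine ⟨σ ∘ y, ?_⟩
  have h' := sameType_comp_equiv σ hσ (Sum.elim x y)
  rw [Sum.comp_elim, show σ ∘ x = a from funext hσx] at h'
  exact h'

end

/-- A correspondence `C` over `A` between a complete type `p = tp(a/A)` and a
type-definable set `π` decomposes as a disjoint union of at most `k = |C_x|` many complete
correspondences (the `≡_A`-classes of elements of `C`). -/
theorem statement6 (L : FirstOrder.Language.{u, v}) (M : Type w) [L.Structure M]
    (A : Set M) (hhom : StronglyHomogeneousOver L A) (n m : ℕ) (a : Fin n → M)
    (π : Set (Fin m → M)) (hπ : TypeDefinable L A π)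
    (C : Set ((Fin n → M) × (Fin m → M)))
    (hC : IsCorrespondence L A (typeSet L A a) π C) (k : ℕ)
    (hk : ∀ x ∈ typeSet L A a, {y | (x, y) ∈ C}.ncard = k) :
    ∃ (N : ℕ) (c : Fin N → (Fin n → M) × (Fin m → M)),
      1 ≤ N ∧ N ≤ k ∧
      (∀ i, c i ∈ C) ∧
      C = ⋃ i, pairClass L A (c i) ∧
      (Pairwise fun i j => Disjoint (pairClass L A (c i)) (pairClass L A (c j))) ∧
      ∀ i, IsCorrespondence L A (typeSet L A a) π (pairClass L A (c i)) := by
  have ha : a ∈ typeSet L A a := SameType.refl L A a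
  have hfin := hC.finite_fibers a ha
  let F := {y | (a, y) ∈ C}
  have : Finite F := hfin
  let r : Setoid F :=
    { r := fun y z => SameType L A (Sum.elim a y.1) (Sum.elim a z.1)
      iseqv := ⟨fun _ => SameType.refl L A _, SameType.symm, SameType.trans⟩ }
  let e := Finite.equivFin (Quotient r)
  have hcover : ∀ p ∈ C, ∃ y : F, SameType L A (Sum.elim a y.1) (Sum.elim p.1 p.2) := by
    rintro ⟨x, y⟩ hp
    obtain ⟨z, hz⟩ := hhom.exists_mem_pairClass (SameType.symm (hC.subset hp).1) y
    exact ⟨⟨z, pairClass_subset hC.typeDefinable hp hz⟩, hz.symm⟩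
  have hmem : ∀ i, (a, (e.symm i).out.1) ∈ C := fun i => (e.symm i).out.2
  refine ⟨Nat.card (Quotient r), fun i => (a, (e.symm i).out.1), ?_, ?_, hmem, ?_, ?_,
    fun i => hC.pairClass (hmem i)⟩
  · obtain ⟨p, hp⟩ := hC.nonempty
    obtain ⟨y, -⟩ := hcover p hp
    have : Nonempty (Quotient r) := ⟨Quotient.mk r y⟩
    exact Nat.card_pos
  · rw [← hk a ha]
    exact Nat.card_le_card_of_surjective _ (Quotient.mk_surjective (s := r))
  · refine Subset.antisymm (fun p hp => ?_)
      (iUnion_subset fun i => pairClass_subset hC.typeDefinable (hmem i))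
    obtain ⟨y, hy⟩ := hcover p hp
    refine mem_iUnion.2 ⟨e (Quotient.mk r y), ?_⟩
    have h : SameType L A (Sum.elim a (Quotient.mk r y).out.1) (Sum.elim a y.1) :=
      Quotient.mk_out (s := r) y
    beta_reduce
    rw [Equiv.symm_apply_apply]
    exact SameType.trans h hy
  · intro i j hij
    refine disjoint_left.2 fun p hi hj => hij (e.symm.injective ?_)
    exact Quotient.out_equiv_out.1 (SameType.trans hi (SameType.symm hj))

end Unimod
end
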